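/- arXiv:1810.11660 — 2 statements merged into one kernel-verified Lean document; each statement's English description precedes it below -/
import Mathlib

section
/- Let n ≥ 7 and let L = F1(α_4,…,α_n,θ) be an n-dimensional complex filiform Leibniz algebra of the first family with α_4 ≠ 0. Then every pre-derivation P of L, writing P(e_1) = Σ_{t=1}^n a_t e_t and P(e_3) = Σ_{t=2}^n c_t e_t in the basis e_1,…,e_n, satisfies a_2 = a_1, c_3 = 3a_1, and c_i = a_{i−1} + a_1 α_i for all 4 ≤ i ≤ n−3. -/
open Finset

/-- The basis vector `e_i` (1-indexed) of `ℂ^n`; zero if `i` is out of range. -/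
noncomputable def E (n : ℕ) (i : ℕ) : Fin n → ℂ :=
  if h : 1 ≤ i ∧ i ≤ n then Pi.single (⟨i - 1, by omega⟩ : Fin n) 1 else 0

/-- The bilinear bracket on `ℂ^n` determined by the products `m i j` of the
(1-indexed) basis vectors `e_i`, `e_j`. -/
noncomputable def bracketOf (n : ℕ) (m : ℕ → ℕ → Fin n → ℂ)
    (x y : Fin n → ℂ) : Fin n → ℂ :=
  ∑ i : Fin n, ∑ j : Fin n, (x i * y j) • m (i.1 + 1) (j.1 + 1)

/-- `P` is a pre-derivation of the algebra with bracket `br`. -/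
def IsPreDeriv (n : ℕ) (br : (Fin n → ℂ) → (Fin n → ℂ) → Fin n → ℂ)
    (P : Module.End ℂ (Fin n → ℂ)) : Prop :=
  ∀ x y z, P (br (br x y) z) =
    br (br (P x) y) z + br (br x (P y)) z + br (br x y) (P z)

/-- Multiplication table of the first family `F1(α₄,…,αₙ,θ)` of filiform Leibniz
algebras: `[e₁,e₁]=e₃`; `[eᵢ,e₁]=e_{i+1}` for `2 ≤ i ≤ n-1`;
`[e₁,e₂]=∑_{t=4}^{n-1} α_t e_t + θ eₙ`; `[eⱼ,e₂]=∑_{t=j+2}^{n} α_{t-j+2} e_t`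
for `2 ≤ j ≤ n-2`; all other products zero. -/
noncomputable def F1mul (n : ℕ) (α : ℕ → ℂ) (θ : ℂ) (i j : ℕ) : Fin n → ℂ :=
  if i = 1 ∧ j = 1 then E n 3
  else if 2 ≤ i ∧ i ≤ n - 1 ∧ j = 1 then E n (i + 1)
  else if i = 1 ∧ j = 2 then (∑ t ∈ Icc 4 (n - 1), α t • E n t) + θ • E n n
  else if 2 ≤ i ∧ i ≤ n - 2 ∧ j = 2 then ∑ t ∈ Icc (i + 2) n, α (t - i + 2) • E n t
  else 0

lemma E_apply (n i : ℕ) (k : Fin n) : E n i k = if i = k.1 + 1 then 1 else 0 := by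
  unfold E
  split_ifs with h h' h'
  · subst h'; simp
  · rw [Pi.single_eq_of_ne]
    intro hk
    apply h'
    have := congrArg Fin.val hk
    simp only at this
    omega
  · omega
  · rfl

lemma E_eq_zero {n i : ℕ} (h : n < i) : E n i = 0 := by
  rw [E, dif_neg (by omega)]

lemma E_succ (n : ℕ) (i : Fin n) : E n (i.1 + 1) = Pi.single i 1 := by
  ext k
  simp [E_apply, Pi.single_apply, Fin.ext_iff, eq_comm]

/-- Endomorphisms agreeing on all `e_i` are equal. -/
lemma end_ext {n : ℕ} {f g : Module.End ℂ (Fin n → ℂ)}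
    (h : ∀ i, 1 ≤ i → f (E n i) = g (E n i)) : f = g := by
  refine LinearMap.pi_ext' fun i => LinearMap.ext_ring ?_
  simpa [E_succ] using h (i.1 + 1) (by omega)

/-- Right multiplication by `y`. -/
noncomputable def rightMul (n : ℕ) (m : ℕ → ℕ → Fin n → ℂ) (y : Fin n → ℂ) :
    Module.End ℂ (Fin n → ℂ) where
  toFun x := bracketOf n m x y
  map_add' x x' := by simp [bracketOf, add_mul, add_smul, sum_add_distrib]
  map_smul' r x := by simp [bracketOf, smul_sum, mul_smul, mul_assoc]

lemma rightMul_apply (n : ℕ) (m : ℕ → ℕ → Fin n → ℂ) (x y : Fin n → ℂ) :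
    rightMul n m y x = bracketOf n m x y := rfl

lemma bracketOf_E_E {n : ℕ} (m : ℕ → ℕ → Fin n → ℂ) {i j : ℕ} (hi : 1 ≤ i) (hin : i ≤ n)
    (hj : 1 ≤ j) (hjn : j ≤ n) : bracketOf n m (E n i) (E n j) = m i j := by
  obtain ⟨i, rfl⟩ := Nat.exists_eq_add_of_le' hi
  obtain ⟨j, rfl⟩ := Nat.exists_eq_add_of_le' hj
  rw [bracketOf, sum_eq_single ⟨i, hin⟩, sum_eq_single ⟨j, hjn⟩]
  · simp [E_apply]
  · intro b _ hb
    have : j ≠ b.1 := fun h => hb (Fin.ext h.symm)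
    simp [E_apply, this]
  · simp
  · intro b _ hb
    have : i ≠ b.1 := fun h => hb (Fin.ext h.symm)
    simp [E_apply, this]
  · simp

section Table

variable {n : ℕ} (α : ℕ → ℂ) (θ : ℂ)

lemma bracketOf_F1mul (hn : 2 ≤ n) (x y : Fin n → ℂ) :
    bracketOf n (F1mul n α θ) x y =
      y ⟨0, by omega⟩ • rightMul n (F1mul n α θ) (E n 1) x +
      y ⟨1, by omega⟩ • rightMul n (F1mul n α θ) (E n 2) x := by
  obtain ⟨n, rfl⟩ := Nat.exists_eq_add_of_le' hn
  have h3 (i j : ℕ) : F1mul (n + 2) α θ i (j + 1 + 1 + 1) = 0 := by simp [F1mul]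
  simp [rightMul, bracketOf, Fin.sum_univ_succ (n := n + 1), Fin.sum_univ_succ (n := n), h3,
    E_apply, smul_sum, sum_add_distrib, mul_smul, smul_comm (x _)]
  abel

lemma rightMul_one_E_one (hn : 2 ≤ n) : rightMul n (F1mul n α θ) (E n 1) (E n 1) = E n 3 := by
  rw [rightMul_apply]
  rw [bracketOf_E_E] <;> first | omega | simp [F1mul]

lemma rightMul_one_E {j : ℕ} (hj : 2 ≤ j) :
    rightMul n (F1mul n α θ) (E n 1) (E n j) = E n (j + 1) := by
  rcases lt_or_ge n j with h | h
  · rw [E_eq_zero h, E_eq_zero (show n < j + 1 by omega), map_zero]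
  rw [rightMul_apply]
  rw [bracketOf_E_E _ (by omega) h le_rfl (by omega), F1mul, if_neg (by omega)]
  rcases h.lt_or_eq with h' | rfl
  · rw [if_pos (by omega)]
  · rw [if_neg (by omega), if_neg (by omega), if_neg (by omega), E_eq_zero (by omega)]

lemma rightMul_two_E_one (hn : 2 ≤ n) : rightMul n (F1mul n α θ) (E n 2) (E n 1) =
    (∑ t ∈ Icc 4 (n - 1), α t • E n t) + θ • E n n := by
  rw [rightMul_apply]
  rw [bracketOf_E_E] <;> first | omega | simp [F1mul]

lemma rightMul_two_E {j : ℕ} (hj : 2 ≤ j) :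
    rightMul n (F1mul n α θ) (E n 2) (E n j) = ∑ t ∈ Icc 4 n, α t • E n (j + t - 2) := by
  rcases lt_or_ge (n - 2) j with h | h
  · rw [sum_eq_zero fun t ht => ?_]
    · rcases lt_or_ge n j with h' | h'
      · rw [E_eq_zero h', map_zero]
      rw [rightMul_apply]
      rw [bracketOf_E_E _ (by omega) h' (by omega) (by omega), F1mul, if_neg (by omega),
        if_neg (by omega), if_neg (by omega), if_neg (by omega)]
    · rw [mem_Icc] at ht
      rw [E_eq_zero (by omega), smul_zero]
  rw [rightMul_apply]
  rw [bracketOf_E_E _ (by omega) (by omega) (by omega) (by omega), F1mul, if_neg (by omega),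
        if_neg (by omega), if_neg (by omega), if_pos (by omega)]
  refine sum_of_injOn (fun t => t - j + 2) ?_ ?_ ?_ ?_
  · intro s hs t ht
    simp only [coe_Icc, Set.mem_Icc] at *
    omega
  · intro t ht
    simp only [coe_Icc, Set.mem_Icc] at *
    omega
  · intro t ht hnt
    rw [E_eq_zero, smul_zero]
    by_contra! hle
    rw [mem_Icc] at ht
    exact hnt ⟨j + t - 2, by simp only [coe_Icc, Set.mem_Icc]; omega, by simp only; omega⟩
  · intro t ht
    rw [mem_Icc] at ht
    rw [show j + (t - j + 2) - 2 = t by omega]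

lemma rightMul_one_pow_E (k : ℕ) {j : ℕ} (hj : 2 ≤ j) :
    (rightMul n (F1mul n α θ) (E n 1) ^ k) (E n j) = E n (j + k) := by
  induction k with
  | zero => rfl
  | succ k ih => rw [pow_succ', Module.End.mul_apply, ih, rightMul_one_E _ _ (by omega)]; rfl

lemma rightMul_one_pow_E_one (hn : 2 ≤ n) {k : ℕ} (hk : 1 ≤ k) :
    (rightMul n (F1mul n α θ) (E n 1) ^ k) (E n 1) = E n (k + 2) := by
  obtain ⟨k, rfl⟩ := Nat.exists_eq_add_of_le' hk
  rw [pow_succ, Module.End.mul_apply, rightMul_one_E_one _ _ hn, rightMul_one_pow_E _ _ _ (by omega)]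
  congr 1
  omega

lemma rightMul_one_pow_eq_zero (hn : 2 ≤ n) : rightMul n (F1mul n α θ) (E n 1) ^ n = 0 := by
  refine end_ext fun i hi => ?_
  rcases hi.eq_or_lt with rfl | hi
  · rw [rightMul_one_pow_E_one _ _ hn (by omega), E_eq_zero (by omega)]; rfl
  · rw [rightMul_one_pow_E _ _ _ hi, E_eq_zero (by omega)]; rfl

lemma rightMul_one_pow_apply_eq_zero (hn : 2 ≤ n) {k : ℕ} (hk : 1 ≤ k) (y : Fin n → ℂ)
    (i : Fin n) (hi : i.1 < k + 1) : (rightMul n (F1mul n α θ) (E n 1) ^ k) y i = 0 := by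
  have : (LinearMap.proj i : (Fin n → ℂ) →ₗ[ℂ] ℂ) ∘ₗ rightMul n (F1mul n α θ) (E n 1) ^ k = 0 := by
    refine LinearMap.pi_ext' fun j => LinearMap.ext_ring ?_
    simp only [LinearMap.comp_apply, LinearMap.single_apply, ← E_succ, LinearMap.proj_apply,
      LinearMap.zero_apply]
    rcases Nat.eq_zero_or_pos j.1 with h | h
    · rw [h, zero_add, rightMul_one_pow_E_one _ _ hn hk, E_apply, if_neg (by omega)]
    · rw [rightMul_one_pow_E _ _ _ (by omega), E_apply, if_neg (by omega)]
  exact LinearMap.congr_fun this y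

lemma rightMul_one_pow_apply (hn : 2 ≤ n) {k : ℕ} (hk : 1 ≤ k) (y : Fin n → ℂ)
    (i : Fin n) (hi : k < i.1) : (rightMul n (F1mul n α θ) (E n 1) ^ k) y i =
      y ⟨i - k, by omega⟩ + if i.1 = k + 1 then y ⟨0, by omega⟩ else 0 := by
  have : (LinearMap.proj i : (Fin n → ℂ) →ₗ[ℂ] ℂ) ∘ₗ rightMul n (F1mul n α θ) (E n 1) ^ k =
      LinearMap.proj ⟨i - k, by omega⟩ +
        if i.1 = k + 1 then LinearMap.proj ⟨0, by omega⟩ else 0 := by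
    refine LinearMap.pi_ext' fun j => LinearMap.ext_ring ?_
    simp only [LinearMap.comp_apply, LinearMap.single_apply, ← E_succ, LinearMap.proj_apply,
      LinearMap.add_apply]
    rcases Nat.eq_zero_or_pos j.1 with h | h
    · rw [h, zero_add, rightMul_one_pow_E_one _ _ hn hk]
      by_cases hik : i.1 = k + 1 <;>
        simp only [hik, if_true, if_false, LinearMap.zero_apply, LinearMap.proj_apply, E_apply] <;>
        split_ifs <;> first | omega | simp
    · rw [rightMul_one_pow_E _ _ _ (by omega)]
      by_cases hik : i.1 = k + 1 <;>
        simp only [hik, if_true, if_false, LinearMap.zero_apply, LinearMap.proj_apply, E_apply] <;>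
        split_ifs <;> first | omega | simp
  have := LinearMap.congr_fun this y
  split_ifs at * <;> simpa using this

lemma rightMul_one_mul_two_E_one (hn : 4 ≤ n) :
    rightMul n (F1mul n α θ) (E n 1) (rightMul n (F1mul n α θ) (E n 2) (E n 1)) =
      ∑ t ∈ Icc 4 n, α t • E n (t + 1) := by
  obtain ⟨m, rfl⟩ := Nat.exists_eq_add_of_le' (show 1 ≤ n by omega)
  rw [rightMul_two_E_one _ _ (by omega), map_add, map_smul, rightMul_one_E _ _ (by omega),
    map_sum, Finset.sum_Icc_succ_top (by omega), E_eq_zero (show m + 1 < m + 1 + 1 by omega)]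
  simp only [smul_zero]
  congr 1
  refine sum_congr rfl fun t ht => ?_
  rw [mem_Icc] at ht
  rw [map_smul, rightMul_one_E _ _ (by omega)]

lemma rightMul_one_mul_two_E {j : ℕ} (hj : 2 ≤ j) :
    rightMul n (F1mul n α θ) (E n 1) (rightMul n (F1mul n α θ) (E n 2) (E n j)) =
      ∑ t ∈ Icc 4 n, α t • E n (j + t - 1) := by
  rw [rightMul_two_E _ _ hj, map_sum]
  refine sum_congr rfl fun t ht => ?_
  rw [mem_Icc] at ht
  rw [map_smul, rightMul_one_E _ _ (by omega), show j + t - 2 + 1 = j + t - 1 by omega]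

lemma rightMul_two_mul_one (hn : 4 ≤ n) :
    rightMul n (F1mul n α θ) (E n 2) * rightMul n (F1mul n α θ) (E n 1) =
      rightMul n (F1mul n α θ) (E n 1) * rightMul n (F1mul n α θ) (E n 2) := by
  refine end_ext fun i hi => ?_
  simp only [Module.End.mul_apply]
  rcases hi.eq_or_lt with rfl | hi
  · rw [rightMul_one_E_one _ _ (by omega), rightMul_one_mul_two_E_one _ _ hn,
      rightMul_two_E _ _ (by omega)]
    refine sum_congr rfl fun t ht => ?_
    rw [show 3 + t - 2 = t + 1 by omega]
  · rw [rightMul_one_E _ _ hi, rightMul_one_mul_two_E _ _ hi, rightMul_two_E _ _ (by omega)]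
    refine sum_congr rfl fun t ht => ?_
    rw [show i + 1 + t - 2 = i + t - 1 by omega]

lemma rightMul_one_mul_two (hn : 4 ≤ n) :
    rightMul n (F1mul n α θ) (E n 1) * rightMul n (F1mul n α θ) (E n 2) =
      α 4 • rightMul n (F1mul n α θ) (E n 1) ^ 3 + rightMul n (F1mul n α θ) (E n 1) ^ 4 *
        ∑ t ∈ Icc 5 n, α t • rightMul n (F1mul n α θ) (E n 1) ^ (t - 5) := by
  have key : rightMul n (F1mul n α θ) (E n 1) * rightMul n (F1mul n α θ) (E n 2) =
      ∑ t ∈ Icc 4 n, α t • rightMul n (F1mul n α θ) (E n 1) ^ (t - 1) := by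
    refine end_ext fun i hi => ?_
    simp only [Module.End.mul_apply, LinearMap.sum_apply, LinearMap.smul_apply]
    rcases hi.eq_or_lt with rfl | hi
    · rw [rightMul_one_mul_two_E_one _ _ hn]
      refine sum_congr rfl fun t ht => ?_
      rw [mem_Icc] at ht
      rw [rightMul_one_pow_E_one _ _ (by omega) (by omega), show t - 1 + 2 = t + 1 by omega]
    · rw [rightMul_one_mul_two_E _ _ hi]
      refine sum_congr rfl fun t ht => ?_
      rw [mem_Icc] at ht
      rw [rightMul_one_pow_E _ _ _ hi, show i + (t - 1) = i + t - 1 by omega]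
  rw [key, ← Finset.add_sum_Ioc_eq_sum_Icc hn, mul_sum]
  congr 1
  refine sum_congr rfl fun t ht => ?_
  rw [mem_Icc] at ht
  rw [mul_smul_comm, ← pow_add, show 4 + (t - 5) = t - 1 by omega]

end Table

section Algebra

variable {A : Type*} [Ring A] [Algebra ℂ A]

/-- If `X` anticommutes with a nilpotent `R` and commutes with `F = r R³ + R⁴ K`, `r ≠ 0`,
where `K` commutes with `R`, then `R³ X = 0`. -/
lemma pow_three_mul_eq_zero {R X K : A} {r : ℂ} (hr : r ≠ 0) {N : ℕ} (hN : R ^ N = 0)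
    (hX : R * X = -(X * R)) (hK : Commute K R)
    (hF : X * (r • R ^ 3 + R ^ 4 * K) = (r • R ^ 3 + R ^ 4 * K) * X) : R ^ 3 * X = 0 := by
  have anti (k : ℕ) : R ^ k * X = (-1 : ℂ) ^ k • (X * R ^ k) := by
    induction k with
    | zero => simp
    | succ k ih =>
      rw [pow_succ, mul_assoc, hX, mul_neg, ← mul_assoc, ih, pow_succ (-1 : ℂ)]
      simp [mul_assoc]
  have step (k : ℕ) (h : R ^ (k + 4) * X = 0) : R ^ (k + 3) * X = 0 := by
    have h' : X * R ^ (k + 4) = 0 := by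
      have := anti (k + 4)
      rw [h] at this
      exact (smul_eq_zero_iff_right (pow_ne_zero _ (by norm_num))).1 this.symm
    have e1 : R ^ k * ((r • R ^ 3 + R ^ 4 * K) * X) = r • (R ^ (k + 3) * X) := by
      have : R ^ k * (R ^ 4 * K * X) = K * (R ^ (k + 4) * X) := by
        rw [← mul_assoc, ← mul_assoc, ← mul_assoc, ← pow_add, (hK.pow_right (k + 4)).eq]
      rw [add_mul, mul_add, this, h, mul_zero, add_zero, smul_mul_assoc, mul_smul_comm, ← mul_assoc,
        ← pow_add]
    have e2 : R ^ k * (X * (r • R ^ 3 + R ^ 4 * K)) = -(r • (R ^ (k + 3) * X)) := by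
      rw [← mul_assoc, anti, anti (k + 3), smul_mul_assoc, mul_assoc, mul_add, mul_smul_comm,
        ← mul_assoc (R ^ k), ← pow_add, ← pow_add, mul_add, ← mul_assoc X, h', zero_mul, add_zero,
        mul_smul_comm, smul_comm, pow_add (-1 : ℂ)]
      norm_num
    rw [hF, e1] at e2
    have h2 : (2 * r) • (R ^ (k + 3) * X) = 0 := by
      rw [two_mul, add_smul]
      nth_rewrite 1 [e2]
      exact neg_add_cancel _
    exact (smul_eq_zero_iff_right (mul_ne_zero two_ne_zero hr)).1 h2
  have down (k : ℕ) (h : R ^ (k + 3) * X = 0) : R ^ 3 * X = 0 := by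
    induction k with
    | zero => simpa using h
    | succ k ih => exact ih (step k h)
  exact down N (by rw [pow_add, hN, zero_mul, zero_mul])

/-- If `[P, R²] = R Q + Q R` and `[P, R S] = R Q' + Q S` with `R`, `S`, `Q`, `Q'` commuting,
then `[P, R] - Q` is annihilated by `R³`. -/
lemma pow_three_mul_commutator_sub_eq_zero {P R S K Q Q' : A} {r : ℂ} (hr : r ≠ 0) {N : ℕ}
    (hN : R ^ N = 0) (hRS : R * S = S * R) (hK : Commute K R)
    (hF : R * S = r • R ^ 3 + R ^ 4 * K)
    (hRQ : R * Q = Q * R) (hSQ : S * Q = Q * S) (hRQ' : R * Q' = Q' * R)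
    (h1 : P * (R * R) = R * R * P + R * Q + Q * R)
    (h2 : P * (R * S) = R * S * P + R * Q' + Q * S) :
    R ^ 3 * (P * R - R * P - Q) = 0 := by
  refine pow_three_mul_eq_zero hr hN ?_ hK ?_
  · have e : R * (P * R - R * P - Q) + (P * R - R * P - Q) * R =
        P * (R * R) - R * R * P - R * Q - Q * R := by noncomm_ring
    rw [h1] at e
    rw [← add_eq_zero_iff_eq_neg, e]
    abel
  · rw [← hF]
    generalize hG : R * Q' + Q * S = G at *
    have hGR : R * G = G * R := by
      rw [← hG, mul_add, add_mul, hRQ', mul_assoc Q, ← hRS, ← mul_assoc, ← mul_assoc, hRQ,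
        ← mul_assoc, ← hRQ']
    generalize hFe : R * S = F at *
    have hFR : R * F = F * R := by rw [← hFe, mul_assoc, ← hRS, hFe]
    have hFQ : F * Q = Q * F := by rw [← hFe, mul_assoc, hSQ, ← mul_assoc, hRQ, mul_assoc]
    rw [add_assoc, hG] at h2
    have hFP : F * P = P * F - G := by rw [h2, add_sub_cancel_right]
    calc (P * R - R * P - Q) * F
        = P * (R * F) - R * (P * F) - Q * F := by noncomm_ring
      _ = P * F * R - G * R - R * (F * P) - F * Q + 0 := by
        rw [hFR, h2, hFQ, mul_add, hGR, ← mul_assoc, h2]; abel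
      _ = (P * F - G) * R - R * F * P - F * Q := by noncomm_ring
      _ = F * (P * R - R * P - Q) := by rw [← hFP, hFR]; noncomm_ring

lemma exists_smul_pow_eq {P R S K : A} {r a b a' b' : ℂ} (hRS : R * S = S * R)
    (hK : K * R = R * K) (hF : R * S = r • R ^ 3 + R ^ 4 * K)
    (h1 : P * (R * R) = R * R * P + R * (a • R + b • S) + (a • R + b • S) * R)
    (h2 : P * (R * S) = R * S * P + R * (a' • R + b' • S) + (a • R + b • S) * S)
    (hX : R ^ 3 * (P * R - R * P - (a • R + b • S)) = 0) :
    ∃ Z, (3 * r * a) • R ^ 5 = a' • R ^ 4 + ((a + b') * r) • R ^ 5 + R ^ 6 * Z := by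
  have hK' (y : A) : K * (R * y) = R * (K * y) := by rw [← mul_assoc, hK, mul_assoc]
  have hRQ : (a • R + b • S) * R = a • (R * R) + b • (R * S) := by
    rw [add_mul, smul_mul_assoc, smul_mul_assoc, hRS]
  have hRQ' : R * (a • R + b • S) = a • (R * R) + b • (R * S) := by
    rw [mul_add, mul_smul_comm, mul_smul_comm]
  have hPR : R ^ 3 * (P * R) = R ^ 4 * P + R ^ 2 * (a • (R * R) + b • (R * S)) := by
    rw [← hRQ']
    rw [mul_sub, mul_sub, sub_sub, sub_eq_zero] at hX
    rw [hX]
    noncomm_ring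
  rw [hRQ, hRQ', hF] at h1
  rw [hF] at hPR
  have hPR3 : R ^ 2 * (P * R ^ 3) =
      R ^ 5 * P + (3 * a) • R ^ 5 + (3 * b) • (R ^ 3 * (r • R ^ 3 + R ^ 4 * K)) := by
    have e : R ^ 2 * (P * R ^ 3) = R ^ 2 * (P * (R * R) * R) := by noncomm_ring
    have e' : R ^ 2 * (R * R * P * R) = R * (R ^ 3 * (P * R)) := by noncomm_ring
    rw [e, h1, add_mul, add_mul, mul_add, mul_add, e', hPR]
    simp only [pow_succ, pow_zero, one_mul, mul_add, add_mul, mul_smul_comm, smul_mul_assoc,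
      mul_assoc, hK]
    module
  have hPR4 : P * R ^ 4 =
      R ^ 4 * P + (4 * a) • R ^ 4 + (4 * b) • (R ^ 2 * (r • R ^ 3 + R ^ 4 * K)) := by
    have e : P * R ^ 4 = P * (R * R) * (R * R) := by noncomm_ring
    have e' : R * R * P * (R * R) = R * R * (P * (R * R)) := by noncomm_ring
    rw [e, h1, add_mul, add_mul, e', h1]
    simp only [pow_succ, pow_zero, one_mul, mul_add, add_mul, mul_smul_comm, smul_mul_assoc,
      mul_assoc, hK, hK']
    module
  have hSS : R ^ 2 * (S * S) = (R * S) * (R * S) := by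
    have e : R ^ 2 * (S * S) = R * (R * S) * S := by noncomm_ring
    rw [e]
    nth_rewrite 1 [hRS]
    noncomm_ring
  have lhs : R ^ 2 * (P * (R * S)) =
      r • (R ^ 2 * (P * R ^ 3)) + R ^ 2 * (P * R ^ 4) * K := by
    rw [hF]
    simp only [mul_add, mul_smul_comm, mul_assoc]
  have rhs : R ^ 2 * (P * (R * S)) = R ^ 2 * (R * S) * P + a' • R ^ 4 +
      (a + b') • (R ^ 2 * (R * S)) + b • (R * S * (R * S)) := by
    rw [h2, ← hSS]
    simp only [pow_succ, pow_zero, one_mul, mul_add, add_mul, mul_smul_comm, smul_mul_assoc,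
      mul_assoc]
    module
  rw [lhs, hPR3, hPR4, hF] at rhs
  refine ⟨K * P - P * K + (a + b' - 4 * a) • K + (-2 * b * r * r) • 1 +
    (-5 * b * r) • (R * K) + (-3 * b) • (R * R * K * K), ?_⟩
  rw [← sub_eq_zero] at rhs ⊢
  rw [← rhs]
  simp only [pow_succ, pow_zero, one_mul, mul_one, mul_add, mul_sub, add_mul, mul_smul_comm,
    smul_mul_assoc, mul_assoc, hK, hK']
  module

end Algebra

/-- If `α₄ ≠ 0` in a first-family filiform Leibniz algebra `F1(α₄,…,αₙ,θ)`
with `n ≥ 7`, then every pre-derivation `P`, with `P(e₁) = ∑_{t=1}^n aₜeₜ` and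
`P(e₃) = ∑_{t=2}^n cₜeₜ`, satisfies `a₂ = a₁`, `c₃ = 3a₁`, and
`cᵢ = a_{i-1} + a₁αᵢ` for `4 ≤ i ≤ n-3`. -/
theorem stmt_16 (n : ℕ) (hn : 7 ≤ n) (α : ℕ → ℂ) (θ : ℂ) (hα4 : α 4 ≠ 0)
    (hleib : ∀ x y z : Fin n → ℂ,
      bracketOf n (F1mul n α θ) (bracketOf n (F1mul n α θ) x y) z =
        bracketOf n (F1mul n α θ) (bracketOf n (F1mul n α θ) x z) y +
        bracketOf n (F1mul n α θ) x (bracketOf n (F1mul n α θ) y z))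
    (P : Module.End ℂ (Fin n → ℂ))
    (hP : IsPreDeriv n (bracketOf n (F1mul n α θ)) P)
    (a c : ℕ → ℂ) (ha : P (E n 1) = ∑ t ∈ Icc 1 n, a t • E n t)
    (hc : P (E n 3) = ∑ t ∈ Icc 2 n, c t • E n t) :
    a 2 = a 1 ∧ c 3 = 3 * a 1 ∧
      ∀ i, 4 ≤ i → i ≤ n - 3 → c i = a (i - 1) + a 1 * α i := by
  have hn2 : 2 ≤ n := by omega
  have hbr := bracketOf_F1mul α θ hn2
  have hcomm := rightMul_two_mul_one α θ (show 4 ≤ n by omega)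
  have hF := rightMul_one_mul_two α θ (show 4 ≤ n by omega)
  have hnil := rightMul_one_pow_eq_zero α θ hn2
  have hlow := fun k hk => rightMul_one_pow_apply_eq_zero α θ hn2 (k := k) hk
  have hcoord := fun k hk => rightMul_one_pow_apply α θ hn2 (k := k) hk
  have hpow := fun k j hj => rightMul_one_pow_E (n := n) α θ k (j := j) hj
  have hpow1 := fun k hk => rightMul_one_pow_E_one α θ hn2 (k := k) hk
  have hR1 := rightMul_one_E_one α θ hn2
  have hS1 := rightMul_two_E_one α θ hn2
  have hRS1 := rightMul_one_mul_two_E_one α θ (show 4 ≤ n by omega)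
  have hRS2 := rightMul_one_mul_two_E (n := n) α θ le_rfl
  have hR2 := rightMul_one_E (n := n) α θ le_rfl
  have happ (i : ℕ) (x) : rightMul n (F1mul n α θ) (E n i) x = bracketOf n (F1mul n α θ) x (E n i) :=
    rightMul_apply ..
  set R := rightMul n (F1mul n α θ) (E n 1)
  set S := rightMul n (F1mul n α θ) (E n 2)
  have hRR (y) : R (R y) = (R ^ 2) y := by rw [pow_two]; rfl
  have hRRR (y) : (R ^ 3) (R y) = (R ^ 4) y := by rw [pow_succ R 3]; rfl
  set K := ∑ t ∈ Icc 5 n, α t • R ^ (t - 5)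
  have hK : Commute K R :=
    Commute.sum_left _ _ _ fun t _ => ((Commute.refl R).pow_left _).smul_left _
  have hPe1 (x) : bracketOf n (F1mul n α θ) x (P (E n 1)) = (a 1 • R + a 2 • S) x := by
    rw [hbr, ha]
    simp [E_apply, show 1 ≤ n by omega, hn2]
  set b₁ := P (E n 2) ⟨0, by omega⟩
  set b₂ := P (E n 2) ⟨1, by omega⟩
  have hPe2 (x) : bracketOf n (F1mul n α θ) x (P (E n 2)) = (b₁ • R + b₂ • S) x :=
    hbr x _
  have h1 : P * (R * R) = R * R * P + R * (a 1 • R + a 2 • S) + (a 1 • R + a 2 • S) * R := by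
    refine LinearMap.ext fun x => ?_
    have := hP x (E n 1) (E n 1)
    simp only [hPe1, ← happ] at this
    exact this
  have h2 : P * (R * S) = R * S * P + R * (b₁ • R + b₂ • S) + (a 1 • R + a 2 • S) * S := by
    refine LinearMap.ext fun x => ?_
    have := hP x (E n 2) (E n 1)
    simp only [hPe1, hPe2, ← happ] at this
    exact this
  have hX : R ^ 3 * (P * R - R * P - (a 1 • R + a 2 • S)) = 0 := by
    refine pow_three_mul_commutator_sub_eq_zero hα4 hnil hcomm.symm hK hF ?_ ?_ ?_ h1 h2 <;>
      simp [mul_add, add_mul, hcomm]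
  have hab : a 1 + a 2 = b₁ + b₂ := by
    have e1 := LinearMap.congr_fun h1 (E n 1)
    have e2 := LinearMap.congr_fun h1 (E n 2)
    simp only [Module.End.mul_apply, LinearMap.add_apply, LinearMap.smul_apply, map_add, map_smul,
      hR1, hR2, hRS1, hRS2] at e1 e2
    rw [e1] at e2
    simp only [show ∀ t, 2 + t - 1 = t + 1 by omega, add_left_inj] at e2
    have e3 := congrFun e2 ⟨3, by omega⟩
    simp only [hRR] at e3
    rw [hcoord 2 (by omega) _ _ (by simp), hcoord 2 (by omega) _ _ (by simp), ha] at e3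
    simp [E_apply, hn2, show 1 ≤ n by omega] at e3
    linear_combination e3
  obtain ⟨Z, hZ⟩ := exists_smul_pow_eq hcomm.symm hK.eq hF h1 h2 hX
  have hZ1 := LinearMap.congr_fun hZ (E n 1)
  simp only [Module.End.mul_apply, LinearMap.add_apply, LinearMap.smul_apply,
    hpow1 4 (by omega), hpow1 5 (by omega)] at hZ1
  have hb1 : b₁ = 0 := by
    have := congrFun hZ1 ⟨5, by omega⟩
    simp only [Pi.add_apply, Pi.smul_apply] at this
    rw [hlow 6 (by omega) _ _ (by simp)] at this
    simpa [E_apply] using this.symm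
  have hb2 : 3 * a 1 = a 1 + b₂ := by
    have := congrFun hZ1 ⟨6, by omega⟩
    simp only [Pi.add_apply, Pi.smul_apply] at this
    rw [hlow 6 (by omega) _ _ (by simp)] at this
    simp [E_apply] at this
    refine mul_left_cancel₀ hα4 ?_
    linear_combination this
  have ha2 : a 2 = a 1 := by linear_combination hab + hb1 - hb2
  have hX1 := LinearMap.congr_fun hX (E n 1)
  simp only [Module.End.mul_apply, LinearMap.add_apply, LinearMap.smul_apply, LinearMap.sub_apply,
    LinearMap.zero_apply, map_add, map_smul, map_sub, hR1] at hX1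
  have hc' (i : ℕ) (h3 : 3 ≤ i) (hi : i ≤ n - 3) :
      c i = a (i - 1) + (if i = 3 then 2 * a 1 else 0) + a 2 * (if 4 ≤ i then α i else 0) := by
    have e := congrFun hX1 ⟨i + 2, by omega⟩
    simp only [Pi.add_apply, Pi.smul_apply, Pi.sub_apply, Pi.zero_apply] at e
    rw [hpow 3 3 (by omega), hRRR,
      hcoord 3 (by omega) _ _ (by simp; omega),
      hcoord 3 (by omega) _ _ (by simp; omega),
      hcoord 4 (by omega) _ _ (by simp; omega), ha, hc, hS1] at e
    simp [E_apply] at e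
    rw [show i - 1 + 1 = i by omega, show i - 2 + 1 = i - 1 by omega] at e
    split_ifs at e ⊢ <;> first | omega | linear_combination e
  refine ⟨ha2, ?_, fun i h4 hi => ?_⟩
  · have := hc' 3 le_rfl (by omega)
    norm_num [ha2] at this
    linear_combination this
  · have := hc' i (by omega) hi
    rwa [if_neg (by omega), if_pos h4, add_zero, ha2] at this
end

section
/- Let n be even with n ≥ 8 and let L = F2(β_4,…,β_n,γ) be an n-dimensional complex filiform Leibniz algebra of the second family, and suppose β_{2s} ≠ 0 for some s with 2 ≤ s ≤ (n−2)/2 while β_{2i} = 0 for all 2 ≤ i ≤ s−1. Then every pre-derivation P of L, writing P(e_1) = Σ_{t=1}^n a_t e_t, P(e_2) = b_2 e_2 + b_{n−1} e_{n−1} + b_n e_n, and P(e_3) = Σ_{t=2}^n c_t e_t in the basis e_1,…,e_n, satisfies b_2 = (2s−2)a_1, c_3 = 2a_1, and c_i = a_{i−1} + a_2 β_i for all 4 ≤ i ≤ n−2s+1. -/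
open Finset

/-- Multiplication table of the second family `F2(β₄,…,βₙ,γ)` of filiform Leibniz
algebras: `[e₁,e₁]=e₃`; `[eᵢ,e₁]=e_{i+1}` for `3 ≤ i ≤ n-1`;
`[e₁,e₂]=∑_{t=4}^{n} β_t e_t`; `[e₂,e₂]=γ eₙ`;
`[eⱼ,e₂]=∑_{t=j+2}^{n} β_{t-j+2} e_t` for `3 ≤ j ≤ n-2`; all other products zero. -/
noncomputable def F2mul (n : ℕ) (β : ℕ → ℂ) (γ : ℂ) (i j : ℕ) : Fin n → ℂ :=
  if i = 1 ∧ j = 1 then E n 3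
  else if 3 ≤ i ∧ i ≤ n - 1 ∧ j = 1 then E n (i + 1)
  else if i = 1 ∧ j = 2 then ∑ t ∈ Icc 4 n, β t • E n t
  else if i = 2 ∧ j = 2 then γ • E n n
  else if 3 ≤ i ∧ i ≤ n - 2 ∧ j = 2 then ∑ t ∈ Icc (i + 2) n, β (t - i + 2) • E n t
  else 0

section

open PowerSeries

/-- The bracket `bracketOf n m` as a bilinear map. -/
noncomputable def bracketBilin (n : ℕ) (m : ℕ → ℕ → Fin n → ℂ) :
    (Fin n → ℂ) →ₗ[ℂ] (Fin n → ℂ) →ₗ[ℂ] (Fin n → ℂ) :=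
  LinearMap.mk₂ ℂ (bracketOf n m)
    (fun x x' y => by simp [bracketOf, add_mul, add_smul, sum_add_distrib])
    (fun r x y => by simp [bracketOf, smul_sum, mul_smul])
    (fun x y y' => by simp [bracketOf, mul_add, add_smul, sum_add_distrib])
    (fun r x y => by simp [bracketOf, smul_sum, mul_smul, smul_comm r])

theorem bracketBilin_apply (n : ℕ) (m : ℕ → ℕ → Fin n → ℂ) (x y : Fin n → ℂ) :
    bracketBilin n m x y = bracketOf n m x y := rfl

theorem E_of_lt {n k : ℕ} (hk : k < n) : E n (k + 1) = Pi.single ⟨k, hk⟩ 1 := by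
  rw [E, dif_pos (by omega)]
  rfl

theorem bracketBilin_E (n : ℕ) (m : ℕ → ℕ → Fin n → ℂ) {i j : ℕ} (hi : 1 ≤ i) (hin : i ≤ n)
    (hj : 1 ≤ j) (hjn : j ≤ n) : bracketBilin n m (E n i) (E n j) = m i j := by
  obtain ⟨i, rfl⟩ := Nat.exists_eq_add_of_le' hi
  obtain ⟨j, rfl⟩ := Nat.exists_eq_add_of_le' hj
  rw [bracketBilin_apply, bracketOf, E_of_lt hin, E_of_lt hjn,
    Finset.sum_eq_single ⟨i, hin⟩, Finset.sum_eq_single ⟨j, hjn⟩]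
  · simp
  · intro k _ hk
    simp [Pi.single_eq_of_ne hk]
  · simp
  · intro k _ hk
    simp [Pi.single_eq_of_ne hk]
  · simp

/-- The map `ℂ⟦X⟧ → ℂⁿ` sending `X ^ k` to `e_{k+3}` (to zero when `k + 3 > n`). -/
noncomputable def ofSeries (n : ℕ) : ℂ⟦X⟧ →ₗ[ℂ] (Fin n → ℂ) where
  toFun f i := if 2 ≤ i.1 then coeff (i.1 - 2) f else 0
  map_add' f g := by
    ext i
    by_cases h : 2 ≤ i.1 <;> simp [h]
  map_smul' r f := by
    ext i
    by_cases h : 2 ≤ i.1 <;> simp [h]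

theorem ofSeries_apply (n : ℕ) (f : ℂ⟦X⟧) (i : Fin n) :
    ofSeries n f i = if 2 ≤ i.1 then coeff (i.1 - 2) f else 0 := rfl

theorem ofSeries_eq_zero_iff {n : ℕ} {f : ℂ⟦X⟧} :
    ofSeries n f = 0 ↔ X ^ (n - 2) ∣ f := by
  rw [X_pow_dvd_iff]
  constructor
  · intro h k hk
    have := congrFun h ⟨k + 2, by omega⟩
    simpa [ofSeries_apply] using this
  · intro h
    ext i
    rw [ofSeries_apply]
    split_ifs with hi
    · exact h _ (by omega)
    · rfl

theorem ofSeries_X_pow {n k : ℕ} (hk : k + 2 < n) : ofSeries n (X ^ k) = E n (k + 3) := by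
  ext i
  rw [E_of_lt hk, ofSeries_apply, coeff_X_pow, Pi.single_apply]
  simp only [Fin.ext_iff]
  split_ifs <;> first | rfl | omega

theorem ofSeries_sum_E (n : ℕ) (f : ℂ⟦X⟧) {r : ℕ} :
    ∑ t ∈ Icc (r + 3) n, coeff (t - (r + 3)) f • E n t = ofSeries n (X ^ r * f) := by
  ext i
  rw [Finset.sum_apply, ofSeries_apply, coeff_X_pow_mul']
  have h : ∀ t ∈ Icc (r + 3) n, (coeff (t - (r + 3)) f • E n t) i =
      if t = i.1 + 1 then coeff (t - (r + 3)) f else 0 := by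
    intro t ht
    rw [mem_Icc] at ht
    obtain ⟨t, rfl⟩ := Nat.exists_eq_add_of_le' (show 1 ≤ t by omega)
    rw [E_of_lt (by omega : t < n), Pi.smul_apply, Pi.single_apply]
    simp [Fin.ext_iff, eq_comm]
  rw [Finset.sum_congr rfl h, Finset.sum_ite_eq']
  have hi := i.2
  simp only [mem_Icc]
  split_ifs <;> first | rfl | omega | (congr 2; omega)

/-- Linear maps vanishing on `X ^ N * ℂ⟦X⟧` agree at `f` as soon as they agree on the monomials of
degree `< N` occurring in `f`. -/
theorem map_eq_of_eq_X_pow {V : Type*} [AddCommGroup V] [Module ℂ V] {N : ℕ}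
    (F G : ℂ⟦X⟧ →ₗ[ℂ] V) (hF : ∀ g, F (X ^ N * g) = 0) (hG : ∀ g, G (X ^ N * g) = 0)
    {f : ℂ⟦X⟧} (h : ∀ k < N, coeff k f ≠ 0 → F (X ^ k) = G (X ^ k)) : F f = G f := by
  rw [eq_X_pow_mul_shift_add_trunc N f, map_add, map_add, hF, hG, trunc_apply,
    ← Polynomial.coeToPowerSeries.ringHom_apply, map_sum, map_sum, map_sum]
  congr 1
  refine Finset.sum_congr rfl fun k hk => ?_
  rw [Polynomial.coeToPowerSeries.ringHom_apply, Polynomial.coe_monomial,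
    monomial_eq_C_mul_X_pow, ← smul_eq_C_mul, map_smul, map_smul]
  by_cases hk0 : coeff k f = 0
  · simp [hk0]
  · rw [h k (by simpa using hk) hk0]

theorem ofSeries_X_pow_mul (n : ℕ) (f : ℂ⟦X⟧) : ofSeries n (X ^ (n - 2) * f) = 0 :=
  ofSeries_eq_zero_iff.2 (dvd_mul_right _ _)

/-- The power series `∑ β_{k+4} X ^ k` of the parameters of `F2`. -/
noncomputable def paramSeries (β : ℕ → ℂ) : ℂ⟦X⟧ := PowerSeries.mk fun k => β (k + 4)

theorem coeff_paramSeries (β : ℕ → ℂ) (k : ℕ) : coeff k (paramSeries β) = β (k + 4) :=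
  coeff_mk _ _

section Bracket

variable {n : ℕ} (β : ℕ → ℂ) (γ : ℂ)

theorem bracket_ofSeries_E_one (hn : 8 ≤ n) (f : ℂ⟦X⟧) :
    bracketBilin n (F2mul n β γ) (ofSeries n f) (E n 1) = ofSeries n (X * f) := by
  refine map_eq_of_eq_X_pow (N := n - 2)
    ((bracketBilin n (F2mul n β γ)).flip (E n 1) ∘ₗ ofSeries n)
    (ofSeries n ∘ₗ LinearMap.mulLeft ℂ X) ?_ ?_ fun k hk _ => ?_
  · intro g
    simp [ofSeries_X_pow_mul]
  · intro g
    rw [LinearMap.comp_apply, LinearMap.mulLeft_apply, mul_left_comm, ofSeries_X_pow_mul]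
  · rw [LinearMap.comp_apply, LinearMap.comp_apply, LinearMap.flip_apply, LinearMap.mulLeft_apply,
      ofSeries_X_pow (by omega), bracketBilin_E _ _ (by omega) (by omega) (by omega) (by omega),
      ← pow_succ']
    by_cases h : k + 3 < n
    · rw [F2mul, if_neg (by omega), if_pos (by omega), ofSeries_X_pow (by omega)]
    · rw [F2mul, if_neg (by omega), if_neg (by omega), if_neg (by omega), if_neg (by omega),
        if_neg (by omega), eq_comm, ofSeries_eq_zero_iff]
      exact pow_dvd_pow _ (by omega)

theorem bracket_ofSeries_E_two (hn : 8 ≤ n) (f : ℂ⟦X⟧) :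
    bracketBilin n (F2mul n β γ) (ofSeries n f) (E n 2) =
      ofSeries n (X ^ 2 * paramSeries β * f) := by
  refine map_eq_of_eq_X_pow (N := n - 2)
    ((bracketBilin n (F2mul n β γ)).flip (E n 2) ∘ₗ ofSeries n)
    (ofSeries n ∘ₗ LinearMap.mulLeft ℂ (X ^ 2 * paramSeries β)) ?_ ?_ fun k hk _ => ?_
  · intro g
    simp [ofSeries_X_pow_mul]
  · intro g
    rw [LinearMap.comp_apply, LinearMap.mulLeft_apply, mul_left_comm, ofSeries_X_pow_mul]
  · rw [LinearMap.comp_apply, LinearMap.comp_apply, LinearMap.flip_apply, LinearMap.mulLeft_apply,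
      ofSeries_X_pow (by omega), bracketBilin_E _ _ (by omega) (by omega) (by omega) (by omega),
      mul_comm, ← mul_assoc, ← pow_add]
    by_cases h : k + 4 < n
    · rw [F2mul, if_neg (by omega), if_neg (by omega), if_neg (by omega), if_neg (by omega),
        if_pos (by omega), ← ofSeries_sum_E]
      refine Finset.sum_congr rfl fun t ht => ?_
      rw [mem_Icc] at ht
      rw [coeff_paramSeries]
      congr 2
      omega
    · rw [F2mul, if_neg (by omega), if_neg (by omega), if_neg (by omega), if_neg (by omega),
        if_neg (by omega), eq_comm, ofSeries_eq_zero_iff]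
      exact (pow_dvd_pow _ (by omega)).mul_right _

theorem bracket_ofSeries_right (x : Fin n → ℂ) (f : ℂ⟦X⟧) :
    bracketBilin n (F2mul n β γ) x (ofSeries n f) = 0 := by
  rw [bracketBilin_apply, bracketOf]
  refine Finset.sum_eq_zero fun i _ => Finset.sum_eq_zero fun j _ => ?_
  rw [ofSeries_apply]
  split_ifs with hj
  · rw [F2mul, if_neg (by omega), if_neg (by omega), if_neg (by omega), if_neg (by omega),
      if_neg (by omega), smul_zero]
  · simp

theorem bracket_E_one_E_one (hn : 8 ≤ n) :
    bracketBilin n (F2mul n β γ) (E n 1) (E n 1) = ofSeries n 1 := by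
  rw [bracketBilin_E _ _ (by omega) (by omega) (by omega) (by omega), F2mul, if_pos (by omega),
    ← pow_zero X, ofSeries_X_pow (by omega)]

theorem bracket_E_one_E_two (hn : 8 ≤ n) :
    bracketBilin n (F2mul n β γ) (E n 1) (E n 2) =
      ofSeries n (X * paramSeries β) := by
  rw [bracketBilin_E _ _ (by omega) (by omega) (by omega) (by omega), F2mul, if_neg (by omega),
    if_neg (by omega), if_pos (by omega), ← pow_one X, ← ofSeries_sum_E]
  refine Finset.sum_congr rfl fun t ht => ?_
  rw [mem_Icc] at ht
  rw [coeff_paramSeries]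
  congr 2
  omega

theorem bracket_E_two_E_one (hn : 8 ≤ n) :
    bracketBilin n (F2mul n β γ) (E n 2) (E n 1) = 0 := by
  rw [bracketBilin_E _ _ (by omega) (by omega) (by omega) (by omega), F2mul, if_neg (by omega),
    if_neg (by omega), if_neg (by omega), if_neg (by omega), if_neg (by omega)]

end Bracket

/-- A linear map given on `X ^ k` by `W * X ^ k + D * (X ^ k)'`, for the monomials occurring in
`f`, is given by the same formula on `f`. -/
theorem map_ofSeries_eq {n : ℕ} (P : Module.End ℂ (Fin n → ℂ)) (W D : ℂ⟦X⟧) (hD : X ∣ D)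
    {f : ℂ⟦X⟧} (h : ∀ k, coeff k f ≠ 0 →
      P (ofSeries n (X ^ k)) = ofSeries n (W * X ^ k + D * derivative ℂ (X ^ k))) :
    P (ofSeries n f) = ofSeries n (W * f + D * derivative ℂ f) := by
  refine map_eq_of_eq_X_pow (N := n - 2) (P ∘ₗ ofSeries n)
    (ofSeries n ∘ₗ (LinearMap.mulLeft ℂ W + LinearMap.mulLeft ℂ D ∘ₗ (derivative ℂ).toLinearMap))
    (fun g => by simp [ofSeries_X_pow_mul]) (fun g => ?_) (fun k _ hk => h k hk)
  obtain ⟨D, rfl⟩ := hD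
  change ofSeries n (W * (X ^ (n - 2) * g) + X * D * derivative ℂ (X ^ (n - 2) * g)) = 0
  rw [ofSeries_eq_zero_iff]
  refine dvd_add (Dvd.intro _ (mul_left_comm _ _ _)) ?_
  rw [Derivation.leibniz, smul_eq_mul, smul_eq_mul, mul_add]
  refine dvd_add (Dvd.intro _ (mul_left_comm _ _ _)) ?_
  rw [Derivation.leibniz_pow, derivative_X]
  rcases Nat.eq_zero_or_pos (n - 2) with h0 | h0
  · simp [h0]
  · refine ⟨(n - 2 : ℕ) * D * g, ?_⟩
    obtain ⟨m, hm⟩ := Nat.exists_eq_add_of_le' h0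
    simp only [hm, nsmul_eq_mul, smul_eq_mul, Nat.add_sub_cancel]
    ring

theorem coeff_mul_derivative_eq_zero {f : ℂ⟦X⟧} {r : ℕ} (h1 : coeff 1 f = 0)
    (h0 : ∀ k < 2 * r, Even k → coeff k f = 0) :
    coeff (2 * r) (f * derivative ℂ f) = 0 := by
  rw [coeff_mul]
  refine Finset.sum_eq_zero fun p hp => ?_
  rw [HasAntidiagonal.mem_antidiagonal] at hp
  rw [coeff_derivative]
  rcases Nat.even_or_odd p.1 with he | ho
  · rcases Nat.eq_zero_or_pos p.2 with hz | hz
    · simp [hz, h1]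
    · simp [h0 p.1 (by omega) he]
  · by_cases h : p.1 = 1
    · simp [h, h1]
    · have : p.1 ≠ 0 := by rintro h; simp [h] at ho
      rw [h0 (p.2 + 1) (by omega) (by grind)]
      simp

/-- The part of `f` of even degree. -/
noncomputable def evenPart (f : ℂ⟦X⟧) : ℂ⟦X⟧ :=
  PowerSeries.mk fun k => if Even k then coeff k f else 0

theorem coeff_evenPart (f : ℂ⟦X⟧) (k : ℕ) :
    coeff k (evenPart f) = if Even k then coeff k f else 0 := coeff_mk _ _

theorem coeff_sub_evenPart (f : ℂ⟦X⟧) (k : ℕ) :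
    coeff k (f - evenPart f) = if Even k then 0 else coeff k f := by
  rw [map_sub, coeff_evenPart]
  split_ifs <;> simp

/-- `X ^ m` divides `U` when `X ^ (r + m)` divides `f * U` and `f` has order `r`. -/
theorem X_pow_dvd_of_mul {f U : ℂ⟦X⟧} {r m : ℕ} (h0 : ∀ k < r, coeff k f = 0)
    (hr : coeff r f ≠ 0) (h : X ^ (r + m) ∣ f * U) : X ^ m ∣ U := by
  obtain ⟨g, rfl⟩ := X_pow_dvd_iff.2 h0
  rw [pow_add, mul_assoc] at h
  have hg : IsUnit g := by
    rw [isUnit_iff_constantCoeff, isUnit_iff_ne_zero]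
    simpa [coeff_X_pow_mul'] using hr
  exact hg.dvd_mul_left.1 ((mul_dvd_mul_iff_left (pow_ne_zero _ X_ne_zero)).1 h)

theorem coeff_X_sq_mul_paramSeries (β : ℕ → ℂ) {k : ℕ} (hk : 2 ≤ k) :
    coeff k (X ^ 2 * paramSeries β) = β (k + 2) := by
  rw [coeff_X_pow_mul', if_pos hk, coeff_paramSeries]
  congr 1
  omega

theorem coeff_X_sq_mul_paramSeries_of_lt (β : ℕ → ℂ) {k : ℕ} (hk : k < 2) :
    coeff k (X ^ 2 * paramSeries β) = 0 := by
  rw [coeff_X_pow_mul', if_neg (by omega)]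

section PreDeriv

variable {n : ℕ} {β : ℕ → ℂ} {γ : ℂ} {P : Module.End ℂ (Fin n → ℂ)}

theorem IsPreDeriv.bracketBilin
    (hP : IsPreDeriv n (bracketOf n (F2mul n β γ)) P) (x y z : Fin n → ℂ) :
    P (bracketBilin n (F2mul n β γ) (bracketBilin n (F2mul n β γ) x y) z) =
      bracketBilin n (F2mul n β γ) (bracketBilin n (F2mul n β γ) (P x) y) z +
      bracketBilin n (F2mul n β γ) (bracketBilin n (F2mul n β γ) x (P y)) z +
      bracketBilin n (F2mul n β γ) (bracketBilin n (F2mul n β γ) x y) (P z) :=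
  hP x y z

variable {a₁ a₂ b₂ c₂ : ℂ} {A H K : ℂ⟦X⟧}

theorem preDeriv_X_sq_mul (hn : 8 ≤ n) (hP : IsPreDeriv n (bracketOf n (F2mul n β γ)) P)
    (ha : P (E n 1) = a₁ • E n 1 + a₂ • E n 2 + ofSeries n A) {e : ℂ} {f g : ℂ⟦X⟧}
    (hf : P (ofSeries n f) = e • E n 2 + ofSeries n g) :
    P (ofSeries n (X ^ 2 * f)) =
      ofSeries n (X ^ 2 * g + 2 * (X * (a₁ • X + a₂ • (X ^ 2 * paramSeries β)) * f)) := by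
  have h := hP.bracketBilin (ofSeries n f) (E n 1) (E n 1)
  rw [ha, hf] at h
  simp only [map_add, map_smul, LinearMap.add_apply, LinearMap.smul_apply,
    bracket_ofSeries_E_one β γ hn, bracket_ofSeries_E_two β γ hn, bracket_ofSeries_right,
    bracket_E_two_E_one β γ hn, map_zero, LinearMap.zero_apply] at h
  rw [sq, mul_assoc, h]
  simp only [← map_smul, smul_zero, zero_add, add_zero, ← map_add]
  congr 1
  simp only [smul_eq_C_mul]
  ring

theorem preDeriv_X (hn : 8 ≤ n) (hP : IsPreDeriv n (bracketOf n (F2mul n β γ)) P)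
    (ha : P (E n 1) = a₁ • E n 1 + a₂ • E n 2 + ofSeries n A) :
    P (ofSeries n X) = ofSeries n
      ((3 * a₁) • X + X ^ 2 * A + (2 * a₂) • (X ^ 2 * paramSeries β)) := by
  have h := hP.bracketBilin (E n 1) (E n 1) (E n 1)
  rw [ha] at h
  simp only [map_add, map_smul, LinearMap.add_apply, LinearMap.smul_apply,
    bracket_ofSeries_E_one β γ hn, bracket_ofSeries_E_two β γ hn, bracket_ofSeries_right,
    bracket_E_two_E_one β γ hn, bracket_E_one_E_one β γ hn, bracket_E_one_E_two β γ hn,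
    map_zero, LinearMap.zero_apply, mul_one] at h
  rw [h]
  simp only [← map_smul, smul_zero, add_zero, ← map_add]
  congr 1
  simp only [smul_eq_C_mul, map_mul, map_ofNat]
  ring

theorem preDeriv_paramSeries (hn : 8 ≤ n) (hP : IsPreDeriv n (bracketOf n (F2mul n β γ)) P)
    (ha : P (E n 1) = a₁ • E n 1 + a₂ • E n 2 + ofSeries n A)
    (hb : P (E n 2) = b₂ • E n 2 + ofSeries n H) :
    P (ofSeries n (X ^ 2 * paramSeries β)) = ofSeries n (X ^ 2 * paramSeries β *
      ((2 * a₁) • 1 + X * A + a₂ • (X * paramSeries β) + b₂ • 1)) := by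
  have h := hP.bracketBilin (E n 1) (E n 1) (E n 2)
  rw [ha, hb] at h
  simp only [map_add, map_smul, LinearMap.add_apply, LinearMap.smul_apply,
    bracket_ofSeries_E_one β γ hn, bracket_ofSeries_E_two β γ hn, bracket_ofSeries_right,
    bracket_E_two_E_one β γ hn, bracket_E_one_E_one β γ hn, bracket_E_one_E_two β γ hn,
    map_zero, LinearMap.zero_apply, mul_one] at h
  rw [h]
  simp only [← map_smul, smul_zero, add_zero, ← map_add]
  congr 1
  simp only [smul_eq_C_mul, map_mul, map_ofNat]
  ring

theorem preDeriv_X_mul_paramSeries (hn : 8 ≤ n)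
    (hP : IsPreDeriv n (bracketOf n (F2mul n β γ)) P)
    (ha : P (E n 1) = a₁ • E n 1 + a₂ • E n 2 + ofSeries n A)
    (hb : P (E n 2) = b₂ • E n 2 + ofSeries n H)
    (hc : P (ofSeries n 1) = c₂ • E n 2 + ofSeries n K) :
    P (ofSeries n (X * (X ^ 2 * paramSeries β))) = ofSeries n (X ^ 2 * paramSeries β *
      (X * K + a₁ • X + a₂ • (X ^ 2 * paramSeries β) + b₂ • X)) := by
  have h := hP.bracketBilin (ofSeries n 1) (E n 1) (E n 2)
  rw [ha, hb, hc] at h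
  simp only [map_add, map_smul, LinearMap.add_apply, LinearMap.smul_apply,
    bracket_ofSeries_E_one β γ hn, bracket_ofSeries_E_two β γ hn, bracket_ofSeries_right,
    bracket_E_two_E_one β γ hn, map_zero, LinearMap.zero_apply, mul_one] at h
  rw [mul_comm X (X ^ 2 * _), h]
  simp only [← map_smul, smul_zero, zero_add, add_zero, ← map_add]
  congr 1
  simp only [smul_eq_C_mul]
  ring

theorem preDeriv_X_pow_even (hn : 8 ≤ n) (hP : IsPreDeriv n (bracketOf n (F2mul n β γ)) P)
    (ha : P (E n 1) = a₁ • E n 1 + a₂ • E n 2 + ofSeries n A)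
    (hc : P (ofSeries n 1) = c₂ • E n 2 + ofSeries n K) (j : ℕ) :
    P (ofSeries n (X ^ (2 * j + 2))) = ofSeries n (K * X ^ (2 * j + 2) +
      (a₁ • X + a₂ • (X ^ 2 * paramSeries β)) * derivative ℂ (X ^ (2 * j + 2))) := by
  induction j with
  | zero =>
    have h := preDeriv_X_sq_mul hn hP ha hc
    rw [mul_one] at h
    rw [mul_zero, zero_add, h]
    congr 1
    simp only [Derivation.leibniz_pow, derivative_X, smul_eq_C_mul, nsmul_eq_mul, smul_eq_mul]
    push_cast
    ring
  | succ j ih =>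
    have h := preDeriv_X_sq_mul hn hP ha (e := 0) (ih.trans (by rw [zero_smul, zero_add]))
    rw [← pow_add] at h
    rw [show 2 * (j + 1) + 2 = 2 + (2 * j + 2) by ring, h]
    congr 1
    simp only [Derivation.leibniz_pow, derivative_X, smul_eq_C_mul, nsmul_eq_mul, smul_eq_mul,
      show 2 + (2 * j + 2) - 1 = 2 * j + 3 by omega, show 2 * j + 2 - 1 = 2 * j + 1 by omega]
    push_cast
    ring

theorem preDeriv_X_pow_odd (hn : 8 ≤ n) (hP : IsPreDeriv n (bracketOf n (F2mul n β γ)) P)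
    (ha : P (E n 1) = a₁ • E n 1 + a₂ • E n 2 + ofSeries n A) (j : ℕ) :
    P (ofSeries n (X ^ (2 * j + 1))) = ofSeries n
      (((2 * a₁) • 1 + X * A + a₂ • (X * paramSeries β)) * X ^ (2 * j + 1) +
      (a₁ • X + a₂ • (X ^ 2 * paramSeries β)) * derivative ℂ (X ^ (2 * j + 1))) := by
  induction j with
  | zero =>
    rw [mul_zero, zero_add, pow_one, preDeriv_X hn hP ha]
    congr 1
    simp only [derivative_X, smul_eq_C_mul, map_mul, map_ofNat]
    ring
  | succ j ih =>
    have h := preDeriv_X_sq_mul hn hP ha (e := 0) (ih.trans (by rw [zero_smul, zero_add]))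
    rw [← pow_add] at h
    rw [show 2 * (j + 1) + 1 = 2 + (2 * j + 1) by ring, h]
    congr 1
    simp only [Derivation.leibniz_pow, derivative_X, smul_eq_C_mul, nsmul_eq_mul, smul_eq_mul,
      show 2 + (2 * j + 1) - 1 = 2 * j + 2 by omega, show 2 * j + 1 - 1 = 2 * j by omega]
    push_cast
    ring

theorem preDeriv_of_even (hn : 8 ≤ n) (hP : IsPreDeriv n (bracketOf n (F2mul n β γ)) P)
    (ha : P (E n 1) = a₁ • E n 1 + a₂ • E n 2 + ofSeries n A)
    (hc : P (ofSeries n 1) = c₂ • E n 2 + ofSeries n K) {f : ℂ⟦X⟧} (hf0 : coeff 0 f = 0)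
    (hf : ∀ k, Odd k → coeff k f = 0) :
    P (ofSeries n f) = ofSeries n
      (K * f + (a₁ • X + a₂ • (X ^ 2 * paramSeries β)) * derivative ℂ f) := by
  refine map_ofSeries_eq P _ _ ⟨a₁ • 1 + a₂ • (X * paramSeries β), ?_⟩ fun k hk => ?_
  · simp only [smul_eq_C_mul]
    ring
  · obtain ⟨j, hj⟩ := Nat.not_odd_iff_even.1 fun h => hk (hf k h)
    have : j ≠ 0 := by
      rintro rfl
      exact hk (by rwa [hj])
    obtain ⟨i, rfl⟩ := Nat.exists_eq_succ_of_ne_zero this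
    rw [show k = 2 * i + 2 by omega]
    exact preDeriv_X_pow_even hn hP ha hc i

theorem preDeriv_of_odd (hn : 8 ≤ n) (hP : IsPreDeriv n (bracketOf n (F2mul n β γ)) P)
    (ha : P (E n 1) = a₁ • E n 1 + a₂ • E n 2 + ofSeries n A) {f : ℂ⟦X⟧}
    (hf : ∀ k, Even k → coeff k f = 0) :
    P (ofSeries n f) = ofSeries n
      (((2 * a₁) • 1 + X * A + a₂ • (X * paramSeries β)) * f +
      (a₁ • X + a₂ • (X ^ 2 * paramSeries β)) * derivative ℂ f) := by
  refine map_ofSeries_eq P _ _ ⟨a₁ • 1 + a₂ • (X * paramSeries β), ?_⟩ fun k hk => ?_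
  · simp only [smul_eq_C_mul]
    ring
  · obtain ⟨j, rfl⟩ := Nat.not_even_iff_odd.1 fun h => hk (hf k h)
    exact preDeriv_X_pow_odd hn hP ha j

/-- With `B = X ^ 2 * paramSeries β` and `D = a₁ X + a₂ B`, a pre-derivation satisfies
`X ^ (n - 3) ∣ 2 * B_even * (K - 2 a₁ - X A - a₂ B / X)` and
`X ^ (n - 3) ∣ 2 * (D * B' - b₂ B)`. -/
theorem preDeriv_dvd (hn : 8 ≤ n) (hP : IsPreDeriv n (bracketOf n (F2mul n β γ)) P)
    (ha : P (E n 1) = a₁ • E n 1 + a₂ • E n 2 + ofSeries n A)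
    (hb : P (E n 2) = b₂ • E n 2 + ofSeries n H)
    (hc : P (ofSeries n 1) = c₂ • E n 2 + ofSeries n K) :
    X ^ (n - 3) ∣ (2 : ℂ) • (evenPart (X ^ 2 * paramSeries β) *
        (K - (2 * a₁) • 1 - X * A - a₂ • (X * paramSeries β))) ∧
      X ^ (n - 3) ∣ (2 : ℂ) • ((a₁ • X + a₂ • (X ^ 2 * paramSeries β)) *
        derivative ℂ (X ^ 2 * paramSeries β) - b₂ • (X ^ 2 * paramSeries β)) := by
  have hB := preDeriv_paramSeries hn hP ha hb
  have hXB := preDeriv_X_mul_paramSeries hn hP ha hb hc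
  have hB0 : coeff 0 (X ^ 2 * paramSeries β) = 0 :=
    coeff_X_sq_mul_paramSeries_of_lt β (by norm_num)
  generalize hBdef : X ^ 2 * paramSeries β = B at *
  generalize hB₁def : X * paramSeries β = B₁ at *
  obtain ⟨O, hO⟩ : ∃ O, O = B - evenPart B := ⟨_, rfl⟩
  have hEO : B = evenPart B + O := by rw [hO]; ring
  have hEodd : ∀ k, Odd k → coeff k (evenPart B) = 0 := fun k hk => by
    rw [coeff_evenPart, if_neg (Nat.not_even_iff_odd.2 hk)]
  have hOeven : ∀ k, Even k → coeff k O = 0 := fun k hk => by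
    rw [hO, coeff_sub_evenPart, if_pos hk]
  have h1 := preDeriv_of_even hn hP ha hc (f := evenPart B)
    (by rw [coeff_evenPart, hB0, ite_self]) hEodd
  have h2 := preDeriv_of_odd hn hP ha hOeven
  have h3 := preDeriv_of_even hn hP ha hc (f := X * O) (by simp) fun k hk => by
    obtain ⟨j, rfl⟩ := hk
    rw [coeff_succ_X_mul]
    exact hOeven _ (even_two_mul j)
  have h4 := preDeriv_of_odd hn hP ha (f := X * evenPart B) fun k hk => by
    cases k with
    | zero => simp
    | succ k =>
      rw [coeff_succ_X_mul]
      exact hEodd _ (by grind)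
  rw [hBdef] at h1 h2 h3 h4
  rw [hB₁def] at h2 h4
  generalize evenPart B = Q at *
  clear hO
  subst hEO
  rw [← sub_eq_zero, map_add, map_add, h1, h2, ← map_add, ← map_sub, ofSeries_eq_zero_iff] at hB
  rw [← sub_eq_zero, mul_add, map_add, map_add, h3, h4, ← map_add, ← map_sub,
    ofSeries_eq_zero_iff] at hXB
  replace hB := (pow_dvd_pow X (by omega : n - 3 ≤ n - 2)).trans hB
  have hminus : X ^ (n - 3) ∣ -(Q * (K - (2 * a₁) • 1 - X * A - a₂ • B₁)) +
      ((a₁ • X + a₂ • (Q + O)) * derivative ℂ (Q + O) - b₂ • (Q + O)) := by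
    rw [show n - 2 = n - 3 + 1 by omega, pow_succ'] at hXB
    refine (mul_dvd_mul_iff_left X_ne_zero).1 (hXB.trans (dvd_of_eq ?_))
    simp only [Derivation.leibniz, map_add, derivative_X, smul_eq_C_mul, smul_eq_mul]
    ring
  constructor
  · refine (dvd_sub hB hminus).trans (dvd_of_eq ?_)
    simp only [map_add, smul_eq_C_mul, map_ofNat]
    ring
  · refine (dvd_add hB hminus).trans (dvd_of_eq ?_)
    simp only [map_add, smul_eq_C_mul, map_ofNat]
    ring

end PreDeriv
end

/-- For even `n ≥ 8`, in a second-family filiform Leibniz algebra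
`F2(β₄,…,βₙ,γ)` with `β_{2s} ≠ 0` and `β_{2i} = 0` for `2 ≤ i ≤ s-1`, every
pre-derivation `P`, with `P(e₁) = ∑_{t=1}^n aₜeₜ`,
`P(e₂) = b₂e₂ + b_{n-1}e_{n-1} + bₙeₙ` and `P(e₃) = ∑_{t=2}^n cₜeₜ`, satisfies
`b₂ = (2s-2)a₁`, `c₃ = 2a₁`, and `cᵢ = a_{i-1} + a₂βᵢ` for `4 ≤ i ≤ n-2s+1`. -/
theorem stmt_17 (n : ℕ) (hne : Even n) (hn : 8 ≤ n) (β : ℕ → ℂ) (γ : ℂ)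
    (s : ℕ) (hs2 : 2 ≤ s) (hsn : s ≤ (n - 2) / 2) (hβs : β (2 * s) ≠ 0)
    (hβ0 : ∀ i, 2 ≤ i → i ≤ s - 1 → β (2 * i) = 0)
    (hleib : ∀ x y z : Fin n → ℂ,
      bracketOf n (F2mul n β γ) (bracketOf n (F2mul n β γ) x y) z =
        bracketOf n (F2mul n β γ) (bracketOf n (F2mul n β γ) x z) y +
        bracketOf n (F2mul n β γ) x (bracketOf n (F2mul n β γ) y z))
    (P : Module.End ℂ (Fin n → ℂ))
    (hP : IsPreDeriv n (bracketOf n (F2mul n β γ)) P)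
    (a b c : ℕ → ℂ) (ha : P (E n 1) = ∑ t ∈ Icc 1 n, a t • E n t)
    (hb : P (E n 2) = b 2 • E n 2 + b (n - 1) • E n (n - 1) + b n • E n n)
    (hc : P (E n 3) = ∑ t ∈ Icc 2 n, c t • E n t) :
    b 2 = (2 * (s : ℂ) - 2) * a 1 ∧ c 3 = 2 * a 1 ∧
      ∀ i, 4 ≤ i → i ≤ n - 2 * s + 1 → c i = a (i - 1) + a 2 * β i := by
  have ha' : P (E n 1) = a 1 • E n 1 + a 2 • E n 2 +
      ofSeries n (PowerSeries.mk fun k => a (k + 3)) := by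
    rw [ha, ← Finset.add_sum_Ioc_eq_sum_Icc (by omega), ← Finset.Icc_add_one_left_eq_Ioc,
      ← Finset.add_sum_Ioc_eq_sum_Icc (by omega), ← Finset.Icc_add_one_left_eq_Ioc, add_assoc (a 1 • E n 1),
      ← one_mul (PowerSeries.mk _), ← pow_zero PowerSeries.X, ← ofSeries_sum_E]
    congr 2
    refine Finset.sum_congr rfl fun t ht => ?_
    rw [mem_Icc] at ht
    rw [PowerSeries.coeff_mk]
    congr 2
    omega
  have hc' : P (ofSeries n 1) = c 2 • E n 2 +
      ofSeries n (PowerSeries.mk fun k => c (k + 3)) := by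
    rw [← pow_zero PowerSeries.X, ofSeries_X_pow (by omega), hc,
      ← Finset.add_sum_Ioc_eq_sum_Icc (by omega), ← Finset.Icc_add_one_left_eq_Ioc,
      ← one_mul (PowerSeries.mk _), ← pow_zero PowerSeries.X, ← ofSeries_sum_E]
    congr 1
    refine Finset.sum_congr rfl fun t ht => ?_
    rw [mem_Icc] at ht
    rw [PowerSeries.coeff_mk]
    congr 2
    omega
  have hb' : P (E n 2) = b 2 • E n 2 + ofSeries n
      (b (n - 1) • PowerSeries.X ^ (n - 4) + b n • PowerSeries.X ^ (n - 3)) := by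
    rw [hb, map_add, map_smul, map_smul, ofSeries_X_pow (by omega), ofSeries_X_pow (by omega),
      add_assoc, show n - 4 + 3 = n - 1 by omega, show n - 3 + 3 = n by omega]
  obtain ⟨hU, hD⟩ := preDeriv_dvd hn hP ha' hb' hc'
  have hB : ∀ k < 2 * (s - 1), Even k →
      PowerSeries.coeff k (PowerSeries.X ^ 2 * paramSeries β) = 0 := by
    intro k hk hke
    by_cases hk2 : k < 2
    · exact coeff_X_sq_mul_paramSeries_of_lt β hk2
    · obtain ⟨i, rfl⟩ := hke
      rw [coeff_X_sq_mul_paramSeries β (by omega), show i + i + 2 = 2 * (i + 1) by ring]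
      exact hβ0 _ (by omega) (by omega)
  have hBs : PowerSeries.coeff (2 * (s - 1)) (PowerSeries.X ^ 2 * paramSeries β) = β (2 * s) := by
    rw [coeff_X_sq_mul_paramSeries β (by omega)]
    congr 1
    omega
  have hUdvd := X_pow_dvd_of_mul (r := 2 * (s - 1)) (m := n - 2 * s - 1)
    (f := (2 : ℂ) • evenPart (PowerSeries.X ^ 2 * paramSeries β)) (fun k hk => by
      rw [map_smul, coeff_evenPart]
      split_ifs with hke
      · rw [hB k hk hke, smul_zero]
      · rw [smul_zero])
    (by
      rw [map_smul, coeff_evenPart, if_pos (even_two_mul _), hBs]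
      simpa using hβs)
    (by rwa [smul_mul_assoc, show 2 * (s - 1) + (n - 2 * s - 1) = n - 3 by omega])
  rw [PowerSeries.X_pow_dvd_iff] at hUdvd hD
  refine ⟨?_, ?_, fun i hi hin => ?_⟩
  · have h := hD (2 * (s - 1)) (by omega)
    have hB1 : PowerSeries.coeff 1 (PowerSeries.X ^ 2 * paramSeries β) = 0 :=
      coeff_X_sq_mul_paramSeries_of_lt β (by norm_num)
    have hBB := coeff_mul_derivative_eq_zero hB1 hB
    rw [add_mul, smul_mul_assoc, smul_mul_assoc, map_smul, map_sub, map_add, map_smul, map_smul,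
      map_smul, hBB, hBs, show 2 * (s - 1) = 2 * (s - 1) - 1 + 1 by omega,
      PowerSeries.coeff_succ_X_mul, PowerSeries.coeff_derivative,
      show 2 * (s - 1) - 1 + 1 = 2 * (s - 1) by omega, hBs,
      Nat.cast_sub (by omega : 1 ≤ 2 * (s - 1)), Nat.cast_mul, Nat.cast_sub (by omega : 1 ≤ s)] at h
    simp only [smul_eq_mul] at h
    push_cast at h
    refine mul_right_cancel₀ hβs ?_
    linear_combination -h / 2
  · have h := hUdvd 0 (by omega)
    simp at h
    linear_combination h
  · have h := hUdvd (i - 3) (by omega)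
    obtain ⟨j, rfl⟩ := Nat.exists_eq_add_of_le' hi
    rw [show j + 4 - 3 = j + 1 by omega, map_sub, map_sub, map_sub, map_smul, map_smul,
      PowerSeries.coeff_succ_X_mul, PowerSeries.coeff_succ_X_mul, coeff_paramSeries,
      PowerSeries.coeff_mk, PowerSeries.coeff_mk, PowerSeries.coeff_one,
      if_neg (Nat.succ_ne_zero j), smul_zero, smul_eq_mul] at h
    rw [show j + 4 - 1 = j + 3 by omega]
    linear_combination h
end
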